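/- Let J be a nonempty subset of ∘I and P ⊆ ∘Δ_J. The following four conditions are equivalent: (i) P is a pointed biclosed set in ∘Δ_J; (ii) P is a pointed coclosed set in ∘Δ_J; (iii) ∘Δ_J∖P is a parabolic set in ∘Δ_J; (iv) P = u∘Δ^K_{J−} for some unique K ⊆ J and unique u ∈ ∘W^K_J. -/

import Mathlib

open scoped Pointwise

section

variable {ι V : Type*} [Fintype ι] [Nonempty ι] [AddCommGroup V] [Module ℝ V]

/-- The length of `w` with respect to a generating set `S` of a group. -/
noncomputable def lenG {G : Type*} [Group G] (S : Set G) (w : G) : ℕ :=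
  sInf {n | ∃ l : List G, (∀ x ∈ l, x ∈ S) ∧ l.length = n ∧ l.prod = w}

/-- `v` is a nonnegative linear combination of the simple roots `α`. -/
def FPosComb (α : ι → V) (v : V) : Prop :=
  ∃ c : ι → ℝ, (∀ i, 0 ≤ c i) ∧ v = ∑ i, c i • α i

/-- The parabolic subgroup `∘W_J = ⟨s_j | j ∈ J⟩` of the Weyl group,
realized inside the group of linear automorphisms of `V`. -/
def WoJ (r : ι → V ≃ₗ[ℝ] V) (J : Set ι) : Subgroup (V ≃ₗ[ℝ] V) :=
  Subgroup.closure (r '' J)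

/-- `∘Δ_J = ∘W_J(∘Π_J)` (so `∘Δ_∅ = ∅`). -/
def DeloJ (α : ι → V) (r : ι → V ≃ₗ[ℝ] V) (J : Set ι) : Set V :=
  {v | ∃ g ∈ WoJ r J, ∃ j ∈ J, v = g (α j)}

/-- `∘Δ^K_{J+} = (∘Δ_J ∖ ∘Δ_K) ∩ ∘Δ₊`. -/
def DeloKJpos (α : ι → V) (r : ι → V ≃ₗ[ℝ] V) (J K : Set ι) : Set V :=
  (DeloJ α r J \ DeloJ α r K) ∩ {v | FPosComb α v}

/-- `∘Δ^K_{J−} = (∘Δ_J ∖ ∘Δ_K) ∩ ∘Δ₋`. -/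
def DeloKJneg (α : ι → V) (r : ι → V ≃ₗ[ℝ] V) (J K : Set ι) : Set V :=
  (DeloJ α r J \ DeloJ α r K) ∩ {v | FPosComb α (-v)}

/-- The set `∘W^K_J` of minimal-length representatives of the right cosets `∘W_J/∘W_K`. -/
def MinReps (r : ι → V ≃ₗ[ℝ] V) (J K : Set ι) : Set (V ≃ₗ[ℝ] V) :=
  {w | w ∈ WoJ r J ∧ ∀ v ∈ WoJ r K, lenG (Set.range r) w ≤ lenG (Set.range r) (w * v)}

/-- `P` is a closed subset relative to the root system `Δo`. -/
def ClosedIn (Δo P : Set V) : Prop :=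
  ∀ ε ∈ P, ∀ η ∈ P, ε + η ∈ Δo → ε + η ∈ P

/-- The hypotheses making `(∘Δ, ∘Π, (s_i)_i)` the root system of a finite-dimensional
simple Lie algebra over `ℝ`: `∘Π = {α_i}` is a linearly independent simple system, the `s_i`
are the corresponding simple reflections, `∘Δ = ∘W(∘Π)` is finite, crystallographic and
reduced, every root is a nonnegative or nonpositive combination of `∘Π` (but not both),
and the Dynkin diagram is connected (simplicity). -/
structure SimpleRootSystem (α : ι → V) (r : ι → V ≃ₗ[ℝ] V) : Prop where
  indep : LinearIndependent ℝ α
  refl_self : ∀ i, r i (α i) = -α i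
  refl_line : ∀ i, ∀ v : V, ∃ c : ℝ, r i v = v - c • α i
  invol : ∀ i, r i * r i = 1
  cryst : ∀ i, ∀ v ∈ DeloJ α r Set.univ, ∃ m : ℤ, r i v = v - m • α i
  base : ∀ v ∈ DeloJ α r Set.univ, Xor' (FPosComb α v) (FPosComb α (-v))
  finite : (DeloJ α r Set.univ).Finite
  reduced : ∀ v ∈ DeloJ α r Set.univ, (2 : ℝ) • v ∉ DeloJ α r Set.univ
  irred : ∀ A : Set ι, (∀ i ∈ A, ∀ j ∈ Aᶜ, r i (α j) = α j) → A = ∅ ∨ A = Set.univ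


set_option linter.unusedSectionVars false

namespace SimpleRootSystem

theorem exists_coord {α : ι → V} {r : ι → V ≃ₗ[ℝ] V} (h : SimpleRootSystem α r) :
    ∃ C : V →ₗ[ℝ] (ι → ℝ), ∀ c : ι → ℝ, C (∑ i, c i • α i) = c := by
  have hk : LinearMap.ker (Fintype.linearCombination ℝ α) = ⊥ := by
    rw [LinearMap.ker_eq_bot]
    exact h.indep.fintypeLinearCombination_injective
  obtain ⟨g, hg⟩ := LinearMap.exists_leftInverse_of_injective _ hk
  refine ⟨g, fun c => ?_⟩
  have := LinearMap.congr_fun hg c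
  simpa [Fintype.linearCombination_apply] using this

/-- Coordinates with respect to the simple roots (extended arbitrarily to `V`). -/
noncomputable def C {α : ι → V} {r : ι → V ≃ₗ[ℝ] V} (h : SimpleRootSystem α r) :
    V →ₗ[ℝ] (ι → ℝ) := h.exists_coord.choose

/-- The span of the simple roots. -/
def U {α : ι → V} {r : ι → V ≃ₗ[ℝ] V} (_ : SimpleRootSystem α r) : Submodule ℝ V :=
  Submodule.span ℝ (Set.range α)

variable {α : ι → V} {r : ι → V ≃ₗ[ℝ] V} (h : SimpleRootSystem α r)

theorem C_sum (c : ι → ℝ) : h.C (∑ i, c i • α i) = c := h.exists_coord.choose_spec c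

theorem C_self (j : ι) : h.C (α j) j = 1 := by
  classical
  have := congrFun (h.C_sum (Pi.single j 1)) j
  simpa [Pi.single_apply] using this

theorem C_ne {i j : ι} (hij : i ≠ j) : h.C (α j) i = 0 := by
  classical
  have := congrFun (h.C_sum (Pi.single j 1)) i
  simpa [Pi.single_apply, hij] using this

theorem mem_U {v : V} : v ∈ h.U ↔ ∑ i, h.C v i • α i = v := by
  constructor
  · intro hv
    obtain ⟨c, rfl⟩ := (Submodule.mem_span_range_iff_exists_fun ℝ).1 hv
    rw [h.C_sum]
  · intro hv
    exact (Submodule.mem_span_range_iff_exists_fun ℝ).2 ⟨_, hv⟩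

theorem α_mem_U (i : ι) : α i ∈ h.U := Submodule.subset_span ⟨i, rfl⟩

theorem ext_U {v w : V} (hv : v ∈ h.U) (hw : w ∈ h.U) (e : ∀ i, h.C v i = h.C w i) : v = w := by
  rw [← h.mem_U.1 hv, ← h.mem_U.1 hw]
  simp [e]

theorem fpos_iff {v : V} (hv : v ∈ h.U) : FPosComb α v ↔ ∀ i, 0 ≤ h.C v i := by
  constructor
  · rintro ⟨c, hc, rfl⟩
    rw [h.C_sum]; exact hc
  · intro hc
    exact ⟨_, hc, (h.mem_U.1 hv).symm⟩

/-- The linear functional of the reflection `r j`. -/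
noncomputable def f (j : ι) : V →ₗ[ℝ] ℝ :=
  (LinearMap.proj j) ∘ₗ h.C ∘ₗ (LinearMap.id - (r j).toLinearMap)

theorem f_apply (j : ι) (v : V) : h.f j v = h.C v j - h.C (r j v) j := by
  simp [f]

theorem r_apply (j : ι) (v : V) : r j v = v - h.f j v • α j := by
  obtain ⟨c, hc⟩ := h.refl_line j v
  rw [f_apply, hc]
  simp [h.C_self]

theorem r_r (h : SimpleRootSystem α r) (j : ι) (v : V) : r j (r j v) = v := by
  have := h.invol j
  exact LinearEquiv.congr_fun this v

theorem C_r_ne {i j : ι} (hij : i ≠ j) (v : V) : h.C (r j v) i = h.C v i := by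
  rw [h.r_apply]; simp [h.C_ne hij]

theorem r_inv (h : SimpleRootSystem α r) (j : ι) : (r j)⁻¹ = r j := inv_eq_of_mul_eq_one_left (h.invol j)

theorem r_mem {J : Set ι} {j : ι} (hj : j ∈ J) : r j ∈ WoJ r J :=
  Subgroup.subset_closure ⟨j, hj, rfl⟩

theorem W_mono {J K : Set ι} (hJK : K ⊆ J) : WoJ r K ≤ WoJ r J :=
  Subgroup.closure_mono (Set.image_mono hJK)

theorem D_mono {J K : Set ι} (hJK : K ⊆ J) : DeloJ α r K ⊆ DeloJ α r J := by
  rintro v ⟨g, hg, j, hj, rfl⟩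
  exact ⟨g, W_mono hJK hg, j, hJK hj, rfl⟩

theorem D_univ {J : Set ι} {v : V} (hv : v ∈ DeloJ α r J) : v ∈ DeloJ α r Set.univ :=
  D_mono (Set.subset_univ _) hv

theorem α_mem {J : Set ι} {j : ι} (hj : j ∈ J) : α j ∈ DeloJ α r J :=
  ⟨1, one_mem _, j, hj, rfl⟩

theorem W_D {J : Set ι} {g : V ≃ₗ[ℝ] V} (hg : g ∈ WoJ r J) {v : V} (hv : v ∈ DeloJ α r J) :
    g v ∈ DeloJ α r J := by
  obtain ⟨k, hk, j, hj, rfl⟩ := hv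
  exact ⟨g * k, mul_mem hg hk, j, hj, rfl⟩

theorem W_D_iff {J : Set ι} {g : V ≃ₗ[ℝ] V} (hg : g ∈ WoJ r J) {v : V} :
    g v ∈ DeloJ α r J ↔ v ∈ DeloJ α r J := by
  refine ⟨fun hv => ?_, W_D hg⟩
  have := W_D (inv_mem hg) hv
  simpa [← LinearEquiv.mul_apply] using this

theorem neg_D (h : SimpleRootSystem α r) {J : Set ι} {v : V} (hv : v ∈ DeloJ α r J) : -v ∈ DeloJ α r J := by
  obtain ⟨k, hk, j, hj, rfl⟩ := hv
  exact ⟨k * r j, mul_mem hk (r_mem hj), j, hj, by simp [LinearEquiv.mul_apply, h.refl_self]⟩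

theorem neg_D_iff (h : SimpleRootSystem α r) {J : Set ι} {v : V} : -v ∈ DeloJ α r J ↔ v ∈ DeloJ α r J :=
  ⟨fun hv => by simpa using h.neg_D hv, h.neg_D⟩

theorem W_ind (h : SimpleRootSystem α r) {J : Set ι} (p : (V ≃ₗ[ℝ] V) → Prop) (one : p 1)
    (step : ∀ j ∈ J, ∀ g ∈ WoJ r J, p g → p (r j * g)) {g : V ≃ₗ[ℝ] V} (hg : g ∈ WoJ r J) :
    p g := by
  refine Subgroup.closure_induction_left (p := fun g _ => p g) one ?_ ?_ hg
  · rintro _ ⟨j, hj, rfl⟩ y hy hp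
    exact step j hj y hy hp
  · rintro _ ⟨j, hj, rfl⟩ y hy hp
    rw [h.r_inv]
    exact step j hj y hy hp

theorem C_W_ne {J : Set ι} {g : V ≃ₗ[ℝ] V} (hg : g ∈ WoJ r J) (v : V) {i : ι} (hi : i ∉ J) :
    h.C (g v) i = h.C v i := by
  refine h.W_ind (fun g => h.C (g v) i = h.C v i) rfl ?_ hg
  intro j hj g _ hp
  rw [LinearEquiv.mul_apply, h.C_r_ne (by rintro rfl; exact hi hj), hp]

theorem W_U {J : Set ι} {g : V ≃ₗ[ℝ] V} (hg : g ∈ WoJ r J) {v : V} (hv : v ∈ h.U) :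
    g v ∈ h.U := by
  refine h.W_ind (fun g => g v ∈ h.U) hv ?_ hg
  intro j hj g _ hp
  rw [LinearEquiv.mul_apply, h.r_apply]
  exact sub_mem hp (Submodule.smul_mem _ _ (h.α_mem_U j))

theorem D_U {J : Set ι} {v : V} (hv : v ∈ DeloJ α r J) : v ∈ h.U := by
  obtain ⟨k, hk, j, hj, rfl⟩ := hv
  exact h.W_U hk (h.α_mem_U j)

theorem f_int (j : ι) {v : V} (hv : v ∈ DeloJ α r Set.univ) : ∃ m : ℤ, h.f j v = m := by
  obtain ⟨m, hm⟩ := h.cryst j v hv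
  refine ⟨m, ?_⟩
  rw [h.f_apply, hm]
  simp [h.C_self]

theorem C_int {v : V} (hv : v ∈ DeloJ α r Set.univ) (i : ι) : ∃ m : ℤ, h.C v i = m := by
  obtain ⟨k, hk, j, hj, rfl⟩ := hv
  refine h.W_ind (fun g => ∃ m : ℤ, h.C (g (α j)) i = m) ?_ ?_ hk
  · by_cases hij : i = j
    · subst hij; exact ⟨1, by simp [h.C_self]⟩
    · exact ⟨0, by simp [h.C_ne hij]⟩
  · rintro k - g hg ⟨m, hm⟩
    by_cases hij : i = k
    · subst hij
      obtain ⟨n, hn⟩ := h.f_int i (W_D hg (α_mem (Set.mem_univ j)))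
      refine ⟨m - n, ?_⟩
      rw [h.f_apply] at hn
      rw [LinearEquiv.mul_apply]
      push_cast
      linarith
    · exact ⟨m, by rw [LinearEquiv.mul_apply, h.C_r_ne hij, hm]⟩

theorem α_ne (h : SimpleRootSystem α r) (i : ι) : α i ≠ 0 := h.indep.ne_zero i

theorem D_ne (h : SimpleRootSystem α r) {J : Set ι} {v : V} (hv : v ∈ DeloJ α r J) : v ≠ 0 := by
  obtain ⟨k, hk, j, hj, rfl⟩ := hv
  simpa using h.α_ne j

/-- Positivity in coordinates. -/
def Pos (v : V) : Prop := ∀ i, 0 ≤ h.C v i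

theorem pos_or {v : V} (hv : v ∈ DeloJ α r Set.univ) : h.Pos v ∨ h.Pos (-v) := by
  have := h.base v hv
  rw [h.fpos_iff (h.D_U hv), h.fpos_iff (h.D_U (h.neg_D hv))] at this
  rcases this with h1 | h1
  · exact Or.inl h1.1
  · exact Or.inr h1.1

theorem not_pos_neg {v : V} (hv : v ∈ DeloJ α r Set.univ) (h1 : h.Pos v) : ¬ h.Pos (-v) := by
  intro h2
  apply h.D_ne hv
  apply h.ext_U (h.D_U hv) (zero_mem _)
  intro i
  have := h1 i
  have := h2 i
  simp at this ⊢
  linarith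

theorem pos_of_coord {v : V} (hv : v ∈ DeloJ α r Set.univ) {i : ι} (hi : 0 < h.C v i) :
    h.Pos v := by
  rcases h.pos_or hv with h1 | h1
  · exact h1
  · have := h1 i
    simp at this
    linarith

theorem pos_α (i : ι) : h.Pos (α i) :=
  h.pos_of_coord (α_mem (Set.mem_univ i)) (i := i) (by simp [h.C_self])

/-- Existence of an invariant form. -/
theorem exists_form : ∃ B : V →ₗ[ℝ] V →ₗ[ℝ] ℝ, (∀ x y, B x y = B y x) ∧
    (∀ g ∈ WoJ r Set.univ, ∀ x ∈ h.U, ∀ y ∈ h.U, B (g x) (g y) = B x y) ∧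
    (∀ x ∈ h.U, x ≠ 0 → 0 < B x x) := by
  classical
  let Φ : Set (ι → V) := {φ | ∃ g ∈ WoJ r Set.univ, φ = fun i => g (α i)}
  have hΦ : Φ.Finite := by
    refine (Set.Finite.pi' (fun _ : ι => h.finite)).subset ?_
    rintro φ ⟨g, hg, rfl⟩ i
    exact W_D hg (α_mem (Set.mem_univ i))
  let L : (ι → V) → V →ₗ[ℝ] V := fun φ => Fintype.linearCombination ℝ φ ∘ₗ h.C
  have hL : ∀ g : V ≃ₗ[ℝ] V, ∀ x ∈ h.U, L (fun i => g (α i)) x = g x := by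
    intro g x hx
    conv_rhs => rw [← h.mem_U.1 hx]
    simp [L, Fintype.linearCombination_apply]
  let l : (ι → V) → ι → V →ₗ[ℝ] ℝ := fun φ k => LinearMap.proj k ∘ₗ h.C ∘ₗ L φ
  let B : V →ₗ[ℝ] V →ₗ[ℝ] ℝ :=
    ∑ φ ∈ hΦ.toFinset, ∑ k, (LinearMap.mul ℝ ℝ).compl₁₂ (l φ k) (l φ k)
  have hB : ∀ x y, B x y = ∑ φ ∈ hΦ.toFinset, ∑ k, l φ k x * l φ k y := by
    intro x y
    simp [B, LinearMap.sum_apply]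
  refine ⟨B, ?_, ?_, ?_⟩
  · intro x y
    simp only [hB, mul_comm]
  · intro g hg x hx y hy
    rw [hB, hB]
    refine Finset.sum_bij' (fun φ _ => fun i => L φ (g (α i)))
      (fun φ _ => fun i => L φ (g⁻¹ (α i))) ?_ ?_ ?_ ?_ ?_
    · intro φ hφ
      obtain ⟨k, hk, rfl⟩ := (hΦ.mem_toFinset).1 hφ
      refine (hΦ.mem_toFinset).2 ⟨k * g, mul_mem hk hg, ?_⟩
      funext i
      rw [hL k _ (h.W_U hg (h.α_mem_U i))]; rfl
    · intro φ hφ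
      obtain ⟨k, hk, rfl⟩ := (hΦ.mem_toFinset).1 hφ
      refine (hΦ.mem_toFinset).2 ⟨k * g⁻¹, mul_mem hk (inv_mem hg), ?_⟩
      funext i
      rw [hL k _ (h.W_U (inv_mem hg) (h.α_mem_U i))]; rfl
    · intro φ hφ
      obtain ⟨k, hk, rfl⟩ := (hΦ.mem_toFinset).1 hφ
      funext i
      have e : (fun i => L (fun i => k (α i)) (g (α i))) = fun i => (k * g) (α i) := by
        funext i
        rw [hL k _ (h.W_U hg (h.α_mem_U i))]; rfl
      simp only [e]
      rw [hL _ _ (h.W_U (inv_mem hg) (h.α_mem_U i)), ← LinearEquiv.mul_apply]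
      simp
    · intro φ hφ
      obtain ⟨k, hk, rfl⟩ := (hΦ.mem_toFinset).1 hφ
      funext i
      have e : (fun i => L (fun i => k (α i)) (g⁻¹ (α i))) = fun i => (k * g⁻¹) (α i) := by
        funext i
        rw [hL k _ (h.W_U (inv_mem hg) (h.α_mem_U i))]; rfl
      simp only [e]
      rw [hL _ _ (h.W_U hg (h.α_mem_U i)), ← LinearEquiv.mul_apply]
      simp
    · intro φ hφ
      obtain ⟨k, hk, rfl⟩ := (hΦ.mem_toFinset).1 hφ
      have e : (fun i => L (fun i => k (α i)) (g (α i))) = fun i => (k * g) (α i) := by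
        funext i
        rw [hL k _ (h.W_U hg (h.α_mem_U i))]; rfl
      simp only [e]
      refine Finset.sum_congr rfl fun m _ => ?_
      simp only [l, LinearMap.comp_apply]
      rw [hL _ _ hx, hL _ _ hy, hL _ _ (h.W_U hg hx), hL _ _ (h.W_U hg hy)]
      rfl
  · intro x hx hx0
    rw [hB]
    have hα : α ∈ hΦ.toFinset := (hΦ.mem_toFinset).2 ⟨1, one_mem _, rfl⟩
    refine Finset.sum_pos' (fun φ _ => Finset.sum_nonneg fun k _ => mul_self_nonneg _) ⟨α, hα, ?_⟩
    obtain ⟨k, hk⟩ : ∃ k, h.C x k ≠ 0 := by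
      by_contra! hc
      exact hx0 (h.ext_U hx (zero_mem _) (by simpa using hc))
    refine Finset.sum_pos' (fun k _ => mul_self_nonneg _) ⟨k, Finset.mem_univ _, ?_⟩
    have : l α k x = h.C x k := by
      have := hL 1 x hx
      simp only [l, LinearMap.comp_apply]
      exact congrArg (fun z => h.C z k) this
    rw [this]
    exact mul_self_pos.2 hk

/-- An invariant form. -/
noncomputable def B : V →ₗ[ℝ] V →ₗ[ℝ] ℝ := h.exists_form.choose

theorem B_symm (x y : V) : h.B x y = h.B y x := h.exists_form.choose_spec.1 x y

theorem B_inv {g : V ≃ₗ[ℝ] V} (hg : g ∈ WoJ r Set.univ) {x y : V} (hx : x ∈ h.U) (hy : y ∈ h.U) :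
    h.B (g x) (g y) = h.B x y := h.exists_form.choose_spec.2.1 g hg x hx y hy

theorem B_pos {x : V} (hx : x ∈ h.U) (hx0 : x ≠ 0) : 0 < h.B x x :=
  h.exists_form.choose_spec.2.2 x hx hx0

theorem B_α (i : ι) : 0 < h.B (α i) (α i) := h.B_pos (h.α_mem_U i) (h.α_ne i)

theorem f_B (j : ι) {x : V} (hx : x ∈ h.U) : h.f j x * h.B (α j) (α j) = 2 * h.B x (α j) := by
  have := h.B_inv (r_mem (Set.mem_univ j)) hx (h.α_mem_U j)
  rw [h.refl_self, h.r_apply j x] at this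
  simp at this
  linarith

/-- proportional roots -/
theorem eq_of_prop {β : V} (hβ : β ∈ DeloJ α r Set.univ) (hp : h.Pos β) {j : ι}
    (hj : ∀ i, i ≠ j → h.C β i = 0) : β = α j := by
  have e : β = h.C β j • α j := by
    apply h.ext_U (h.D_U hβ) (Submodule.smul_mem _ _ (h.α_mem_U j))
    intro i
    by_cases hij : i = j
    · subst hij; simp [h.C_self]
    · simp [h.C_ne hij, hj i hij]
  obtain ⟨m, hm⟩ := h.C_int hβ j
  rw [hm] at e
  have hm0 : 0 ≤ m := by have := hp j; rw [hm] at this; exact_mod_cast this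
  obtain ⟨g, hg, i, -, rfl⟩ := hβ
  have e2 : α i = (m : ℝ) • g⁻¹ (α j) := by
    have := congrArg (fun z => g⁻¹ z) e
    simp only [← LinearEquiv.mul_apply, map_smul] at this
    simpa only [inv_mul_cancel, LinearEquiv.coe_one, id] using this
  obtain ⟨n, hn⟩ := h.C_int (W_D (inv_mem hg) (α_mem (Set.mem_univ j))) i
  have e3 : (1 : ℝ) = m * n := by
    have := congrArg (fun z => h.C z i) e2
    simp only [map_smul, Pi.smul_apply, smul_eq_mul, hn, h.C_self] at this
    exact this
  have e4 : m * n = 1 := by exact_mod_cast e3.symm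
  have : m = 1 := by
    rcases Int.isUnit_iff.1 (IsUnit.of_mul_eq_one n e4) with h1 | h1
    · exact h1
    · omega
  rw [this] at e
  simpa using e

theorem exists_other {β : V} (hβ : β ∈ DeloJ α r Set.univ) (hp : h.Pos β) {j : ι}
    (hj : β ≠ α j) : ∃ i, i ≠ j ∧ 0 < h.C β i := by
  by_contra! hc
  exact hj (h.eq_of_prop hβ hp fun i hi => le_antisymm (hc i hi) (hp i))

theorem pos_r {β : V} (hβ : β ∈ DeloJ α r Set.univ) (hp : h.Pos β) {j : ι}
    (hj : β ≠ α j) : h.Pos (r j β) := by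
  obtain ⟨i, hi, hc⟩ := h.exists_other hβ hp hj
  refine h.pos_of_coord (W_D (r_mem (Set.mem_univ j)) hβ) (i := i) ?_
  rwa [h.C_r_ne hi]

theorem exists_f_pos {β : V} (hβ : β ∈ DeloJ α r Set.univ) (hp : h.Pos β) :
    ∃ j, 0 < h.C β j ∧ 0 < h.f j β := by
  by_contra! hc
  have h1 := h.B_pos (h.D_U hβ) (h.D_ne hβ)
  have h2 : h.B β β = ∑ i, h.C β i * h.B β (α i) := by
    have := congrArg (fun z => h.B β z) (h.mem_U.1 (h.D_U hβ))
    simp only [map_sum, map_smul, smul_eq_mul] at this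
    exact this.symm
  have h3 : h.B β β ≤ 0 := by
    rw [h2]
    refine Finset.sum_nonpos fun i _ => ?_
    rcases (hp i).eq_or_lt with h0 | h0
    · rw [← h0]; simp
    · have := hc i h0
      have h4 := h.f_B i (h.D_U hβ)
      have h5 := h.B_α i
      have : h.B β (α i) ≤ 0 := by nlinarith
      exact mul_nonpos_of_nonneg_of_nonpos h0.le this
  linarith

/-- height -/
noncomputable def ht (v : V) : ℝ := ∑ i, h.C v i

theorem ht_α (j : ι) : h.ht (α j) = 1 := by
  classical
  rw [ht, Finset.sum_eq_single j, h.C_self]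
  · intro i _ hi; exact h.C_ne hi
  · simp

theorem ht_sub_smul (v : V) (c : ℝ) (j : ι) : h.ht (v - c • α j) = h.ht v - c := by
  have := h.ht_α j
  simp only [ht] at *
  simp [Finset.sum_sub_distrib, ← Finset.mul_sum, this]

theorem ht_pos {v : V} {j : ι} (hp : h.Pos v) (hj : 0 < h.C v j) : 0 < h.ht v :=
  Finset.sum_pos' (fun i _ => hp i) ⟨j, Finset.mem_univ _, hj⟩

theorem f_ge_one {j : ι} {β : V} (hβ : β ∈ DeloJ α r Set.univ) (hf : 0 < h.f j β) :
    1 ≤ h.f j β := by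
  obtain ⟨m, hm⟩ := h.f_int j hβ
  rw [hm] at hf ⊢
  have : 0 < m := by exact_mod_cast hf
  exact_mod_cast this

theorem mem_DJ_pos {J : Set ι} (n : ℕ) : ∀ β ∈ DeloJ α r Set.univ, h.Pos β →
    (∀ i ∉ J, h.C β i = 0) → h.ht β ≤ n → β ∈ DeloJ α r J := by
  induction n with
  | zero =>
    intro β hβ hp _ hn
    obtain ⟨j, hj, -⟩ := h.exists_f_pos hβ hp
    have := h.ht_pos hp hj
    simp at hn
    linarith
  | succ n ih =>
    intro β hβ hp hs hn
    obtain ⟨j, hj, hf⟩ := h.exists_f_pos hβ hp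
    have hjJ : j ∈ J := by
      by_contra hc
      rw [hs j hc] at hj
      exact lt_irrefl _ hj
    by_cases e : β = α j
    · subst e; exact α_mem hjJ
    have h1 : r j β ∈ DeloJ α r J := by
      refine ih _ (W_D (r_mem (Set.mem_univ j)) hβ) (h.pos_r hβ hp e) ?_ ?_
      · intro i hi
        rw [h.C_r_ne (by rintro rfl; exact hi hjJ), hs i hi]
      · rw [h.r_apply, h.ht_sub_smul]
        have := h.f_ge_one hβ hf
        push_cast at hn
        linarith
    exact (W_D_iff (r_mem hjJ)).1 h1

theorem mem_DJ {J : Set ι} {β : V} :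
    β ∈ DeloJ α r J ↔ β ∈ DeloJ α r Set.univ ∧ ∀ i ∉ J, h.C β i = 0 := by
  constructor
  · intro hβ
    refine ⟨D_univ hβ, fun i hi => ?_⟩
    obtain ⟨g, hg, j, hj, rfl⟩ := hβ
    rw [h.C_W_ne hg _ hi, h.C_ne (by rintro rfl; exact hi hj)]
  · rintro ⟨hβ, hs⟩
    rcases h.pos_or hβ with hp | hp
    · obtain ⟨n, hn⟩ := exists_nat_ge (h.ht β)
      exact h.mem_DJ_pos n β hβ hp hs hn
    · obtain ⟨n, hn⟩ := exists_nat_ge (h.ht (-β))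
      refine h.neg_D_iff.1 (h.mem_DJ_pos n (-β) (h.neg_D hβ) hp ?_ hn)
      intro i hi
      simp [hs i hi]

theorem sub_mem_D {β : V} (hβ : β ∈ DeloJ α r Set.univ) {j : ι}
    (hj : β ≠ α j) (hf : 0 < h.f j β) : β - α j ∈ DeloJ α r Set.univ := by
  have hαj : α j ∈ DeloJ α r Set.univ := α_mem (Set.mem_univ j)
  obtain ⟨m, hm⟩ := h.f_int j hβ
  have hm0 : 0 < m := by rw [hm] at hf; exact_mod_cast hf
  by_cases hm1 : m = 1
  · have := W_D (r_mem (Set.mem_univ j)) hβ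
    rw [h.r_apply, hm, hm1] at this
    simpa using this
  have hβ' := hβ
  obtain ⟨g, hg, i, -, e⟩ := hβ'
  have hgj := W_D (inv_mem hg) hαj
  obtain ⟨n, hn⟩ := h.f_int i hgj
  have hs : α j - (n : ℝ) • β ∈ DeloJ α r Set.univ := by
    have := W_D hg (W_D (r_mem (Set.mem_univ i)) hgj)
    rw [h.r_apply, hn, map_sub, map_smul, ← e, ← LinearEquiv.mul_apply] at this
    simpa using this
  have hfB := h.f_B j (h.D_U hβ)
  have hfB2 := h.f_B i (h.D_U hgj)
  rw [← h.B_inv hg (h.α_mem_U i) (h.α_mem_U i), ← h.B_inv hg (h.D_U hgj) (h.α_mem_U i),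
    ← LinearEquiv.mul_apply, ← e, hn] at hfB2
  simp only [mul_inv_cancel, LinearEquiv.coe_one, id] at hfB2
  rw [h.B_symm (α j) β] at hfB2
  rw [hm] at hfB
  have hb := h.B_α j
  have ha := h.B_pos (h.D_U hβ) (h.D_ne hβ)
  have hm2 : (2 : ℝ) ≤ m := by
    have : 2 ≤ m := by omega
    exact_mod_cast this
  have hn0 : 0 < n := by
    by_contra hc
    have : (n : ℝ) ≤ 0 := by push Not at hc; exact_mod_cast hc
    nlinarith
  by_cases hn1 : n = 1
  · rw [hn1] at hs
    have := h.neg_D hs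
    simpa using this
  exfalso
  have hn2 : (2 : ℝ) ≤ n := by
    have : 2 ≤ n := by omega
    exact_mod_cast this
  have := h.B_pos (sub_mem (h.D_U hβ) (h.α_mem_U j)) (sub_ne_zero.2 hj)
  simp only [map_sub, LinearMap.sub_apply] at this
  rw [h.B_symm (α j) β] at this
  nlinarith

theorem sub_pos' {β : V} (hβ : β ∈ DeloJ α r Set.univ) (hp : h.Pos β) {j : ι}
    (hj : β ≠ α j) (hs : β - α j ∈ DeloJ α r Set.univ) : h.Pos (β - α j) := by
  obtain ⟨i, hi, hc⟩ := h.exists_other hβ hp hj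
  refine h.pos_of_coord hs (i := i) ?_
  simpa [h.C_ne hi] using hc

theorem pos_induction {J : Set ι} (p : V → Prop) (simple : ∀ j ∈ J, p (α j))
    (step : ∀ β j, j ∈ J → β ∈ DeloJ α r J → h.Pos β → β + α j ∈ DeloJ α r J →
      p β → p (β + α j)) {β : V} (hβ : β ∈ DeloJ α r J) (hp : h.Pos β) : p β := by
  have key : ∀ n : ℕ, ∀ β ∈ DeloJ α r J, h.Pos β → h.ht β ≤ n → p β := by
    intro n
    induction n with
    | zero =>
      intro β hβ hp hn
      obtain ⟨j, hj, -⟩ := h.exists_f_pos (D_univ hβ) hp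
      have := h.ht_pos hp hj
      simp at hn
      linarith
    | succ n ih =>
      intro β hβ hp hn
      have hβu := D_univ hβ
      obtain ⟨j, hj, hf⟩ := h.exists_f_pos hβu hp
      have hs := (h.mem_DJ.1 hβ).2
      have hjJ : j ∈ J := by
        by_contra hc
        rw [hs j hc] at hj
        exact lt_irrefl _ hj
      by_cases e : β = α j
      · rw [e]; exact simple j hjJ
      have h1 := h.sub_mem_D hβu e hf
      have h2 := h.sub_pos' hβu hp e h1
      have h3 : β - α j ∈ DeloJ α r J := by
        refine h.mem_DJ.2 ⟨h1, fun i hi => ?_⟩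
        rw [map_sub, Pi.sub_apply, hs i hi, h.C_ne (by rintro rfl; exact hi hjJ), sub_zero]
      have h4 : p (β - α j) := by
        refine ih _ h3 h2 ?_
        have := h.ht_sub_smul β 1 j
        rw [one_smul] at this
        push_cast at hn
        linarith
      have := step _ j hjJ h3 h2 (by simpa using hβ) h4
      simpa using this
  obtain ⟨n, hn⟩ := exists_nat_ge (h.ht β)
  exact key n β hβ hp hn

end SimpleRootSystem


namespace SimpleRootSystem

variable {α : ι → V} {r : ι → V ≃ₗ[ℝ] V} (h : SimpleRootSystem α r)

theorem eq_zero_of_f {x : V} (hx : x ∈ h.U) (hf : ∀ i, h.f i x = 0) : x = 0 := by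
  by_contra hc
  have h1 := h.B_pos hx hc
  have := congrArg (fun z => h.B x z) (h.mem_U.1 hx)
  simp only [map_sum, map_smul, smul_eq_mul] at this
  have h2 : ∀ i, h.B x (α i) = 0 := by
    intro i
    have := h.f_B i hx
    rw [hf i] at this
    linarith
  simp only [h2, mul_zero, Finset.sum_const_zero] at this
  linarith

theorem exists_fix (v : V) : ∃ u ∈ h.U, ∀ i, h.f i u = h.f i v := by
  let T : (ι → ℝ) →ₗ[ℝ] (ι → ℝ) :=
    LinearMap.pi (fun i => h.f i) ∘ₗ Fintype.linearCombination ℝ α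
  have hT : ∀ c i, T c i = h.f i (∑ k, c k • α k) := by
    intro c i
    simp [T, Fintype.linearCombination_apply]
  have hinj : Function.Injective T := by
    rw [← LinearMap.ker_eq_bot, LinearMap.ker_eq_bot']
    intro c hc
    have h0 : ∑ k, c k • α k = 0 := by
      apply h.eq_zero_of_f
      · exact (Submodule.mem_span_range_iff_exists_fun ℝ).2 ⟨c, rfl⟩
      · intro i
        rw [← hT, hc]; rfl
    have := h.C_sum c
    rw [h0] at this
    simpa using this.symm
  obtain ⟨c, hc⟩ := LinearMap.injective_iff_surjective.1 hinj (fun i => h.f i v)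
  refine ⟨∑ k, c k • α k, (Submodule.mem_span_range_iff_exists_fun ℝ).2 ⟨c, rfl⟩, fun i => ?_⟩
  rw [← hT, hc]

theorem W_fix {n : V} (hn : ∀ i, h.f i n = 0) {J : Set ι} {g : V ≃ₗ[ℝ] V} (hg : g ∈ WoJ r J) :
    g n = n := by
  refine h.W_ind (fun g => g n = n) rfl ?_ hg
  intro j _ g _ hp
  rw [LinearEquiv.mul_apply, hp, h.r_apply, hn]
  simp

theorem conj (h : SimpleRootSystem α r) {w : V ≃ₗ[ℝ] V} (hw : w ∈ WoJ r Set.univ) {k i : ι} (e : w (α k) = α i) :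
    w * r k = r i * w := by
  apply LinearEquiv.ext
  intro v
  obtain ⟨u, hu, huf⟩ := h.exists_fix v
  have hn : ∀ i, h.f i (v - u) = 0 := by
    intro i; rw [map_sub, huf, sub_self]
  have hv : v = u + (v - u) := by abel
  have e1 : w (r k u) = r i (w u) := by
    rw [h.r_apply, h.r_apply, map_sub, map_smul, e]
    have h1 := h.f_B i (h.W_U hw hu)
    have h2 := h.f_B k hu
    rw [← h.B_inv hw hu (h.α_mem_U k), ← h.B_inv hw (h.α_mem_U k) (h.α_mem_U k), e] at h2
    have h3 := h.B_α i
    have : h.f i (w u) = h.f k u := by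
      apply mul_right_cancel₀ h3.ne'
      rw [h1, h2]
    rw [this]
  rw [LinearEquiv.mul_apply, LinearEquiv.mul_apply, hv, map_add, map_add, map_add, map_add, e1,
    h.W_fix hn (r_mem (Set.mem_univ k)), h.W_fix hn hw, h.W_fix hn (r_mem (Set.mem_univ i))]

/-- The product of a word. -/
def word (r : ι → V ≃ₗ[ℝ] V) (l : List ι) : V ≃ₗ[ℝ] V := (l.map r).prod

theorem word_cons (i : ι) (l : List ι) : word r (i :: l) = r i * word r l := by
  simp [word]

theorem word_mem {J : Set ι} {l : List ι} (hl : ∀ i ∈ l, i ∈ J) : word r l ∈ WoJ r J := by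
  apply Subgroup.list_prod_mem
  intro x hx
  obtain ⟨i, hi, rfl⟩ := List.mem_map.1 hx
  exact r_mem (hl i hi)

theorem exists_word (h : SimpleRootSystem α r) {J : Set ι} {g : V ≃ₗ[ℝ] V} (hg : g ∈ WoJ r J) :
    ∃ l : List ι, (∀ i ∈ l, i ∈ J) ∧ word r l = g := by
  refine h.W_ind (fun g => ∃ l : List ι, (∀ i ∈ l, i ∈ J) ∧ word r l = g) ⟨[], by simp, rfl⟩ ?_ hg
  rintro j hj g _ ⟨l, hl, rfl⟩
  refine ⟨j :: l, ?_, word_cons j l⟩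
  intro i hi
  rcases List.mem_cons.1 hi with rfl | hi
  · exact hj
  · exact hl i hi

theorem exchange (k : ι) (l : List ι) : ¬ h.Pos (word r l (α k)) →
    ∃ l' : List ι, l' ⊆ l ∧ l'.length + 1 = l.length ∧ word r l * r k = word r l' := by
  induction l with
  | nil =>
    intro hn
    exact absurd (h.pos_α k) hn
  | cons i t ih =>
    intro hn
    by_cases hp : h.Pos (word r t (α k))
    · have ht : word r t ∈ WoJ r Set.univ := word_mem (fun _ _ => Set.mem_univ _)
      have e : word r t (α k) = α i := by
        by_contra hc
        apply hn
        rw [word_cons, LinearEquiv.mul_apply]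
        exact h.pos_r (W_D ht (α_mem (Set.mem_univ k))) hp hc
      refine ⟨t, by simp, by simp, ?_⟩
      rw [word_cons, mul_assoc, h.conj ht e, ← mul_assoc, h.invol, one_mul]
    · obtain ⟨l', h1, h2, h3⟩ := ih hp
      refine ⟨i :: l', ?_, by simp [h2], ?_⟩
      · exact List.cons_subset_cons i h1
      · rw [word_cons, word_cons, mul_assoc, h3]

theorem word_eq_one {J : Set ι} (n : ℕ) : ∀ l : List ι, l.length ≤ n → (∀ i ∈ l, i ∈ J) →
    (∀ j ∈ J, h.Pos (word r l (α j))) → word r l = 1 := by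
  induction n with
  | zero =>
    intro l hl _ _
    have : l = [] := List.length_eq_zero_iff.1 (by omega)
    rw [this]; rfl
  | succ n ih =>
    intro l hl hJ hp
    rcases List.eq_nil_or_concat l with rfl | ⟨l0, j, rfl⟩
    · rfl
    have hj : j ∈ J := hJ j (by simp)
    have e : word r (l0.concat j) = word r l0 * r j := by simp [word]
    have hw : word r (l0.concat j) ∈ WoJ r Set.univ := word_mem (fun _ _ => Set.mem_univ _)
    have hn : ¬ h.Pos (word r l0 (α j)) := by
      have h1 := h.not_pos_neg (W_D hw (α_mem (Set.mem_univ j))) (hp j hj)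
      rw [e, LinearEquiv.mul_apply, h.refl_self, map_neg, neg_neg] at h1
      exact h1
    obtain ⟨l', h1, h2, h3⟩ := h.exchange j l0 hn
    rw [h3] at e
    rw [e]
    refine ih l' ?_ ?_ ?_
    · simp at hl; omega
    · intro i hi
      exact hJ i (by simp [h1 hi])
    · intro i hi
      rw [← e]; exact hp i hi

theorem eq_one_of_pos {J : Set ι} {w : V ≃ₗ[ℝ] V} (hw : w ∈ WoJ r J)
    (hp : ∀ j ∈ J, h.Pos (w (α j))) : w = 1 := by
  obtain ⟨l, hl, rfl⟩ := h.exists_word hw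
  exact h.word_eq_one _ l le_rfl hl hp

theorem minRep_pos {J K : Set ι} {u : V ≃ₗ[ℝ] V} (hu : u ∈ MinReps r J K) {k : ι} (hk : k ∈ K) :
    h.Pos (u (α k)) := by
  by_contra hn
  have hne : {n | ∃ l : List (V ≃ₗ[ℝ] V), (∀ x ∈ l, x ∈ Set.range r) ∧ l.length = n ∧
      l.prod = u}.Nonempty := by
    obtain ⟨l, -, hl⟩ := h.exists_word hu.1
    exact ⟨_, l.map r, by simp, rfl, hl⟩
  obtain ⟨l, h1, h2, h3⟩ := Nat.sInf_mem hne
  have : l ∈ Set.range (List.map r) := by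
    rw [Set.range_list_map]; exact h1
  obtain ⟨m, rfl⟩ := this
  have h3' : word r m = u := h3
  obtain ⟨m', -, h5, h6⟩ := h.exchange k m (by rw [h3']; exact hn)
  have h7 := hu.2 (r k) (r_mem hk)
  have h8 : lenG (Set.range r) (u * r k) ≤ m'.length := by
    apply Nat.sInf_le
    refine ⟨m'.map r, by simp, by simp, ?_⟩
    rw [← h3', h6]; rfl
  have h9 : lenG (Set.range r) u = m.length := by
    rw [lenG, ← h2]; simp
  omega

theorem minRep_pos' {J K : Set ι} {u : V ≃ₗ[ℝ] V} (hu : u ∈ MinReps r J K) {β : V}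
    (hβ : β ∈ DeloJ α r K) (hp : h.Pos β) : h.Pos (u β) := by
  refine h.pos_induction (fun β => h.Pos (u β)) (fun j hj => h.minRep_pos hu hj) ?_ hβ hp
  intro β j hj _ _ _ hβ i
  have h1 := hβ i
  have h2 := h.minRep_pos hu hj i
  rw [map_add, map_add, Pi.add_apply]
  linarith

/-- The standard parabolic set. -/
def Qs (J K : Set ι) : Set V := {v | v ∈ DeloJ α r J ∧ (v ∈ DeloJ α r K ∨ h.Pos v)}

theorem mem_N {J K : Set ι} {v : V} : v ∈ DeloKJneg α r J K ↔ v ∈ DeloJ α r J ∧ v ∉ h.Qs J K := by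
  constructor
  · rintro ⟨⟨h1, h2⟩, h3⟩
    refine ⟨h1, ?_⟩
    rintro ⟨-, h4 | h4⟩
    · exact h2 h4
    · exact h.not_pos_neg (D_univ h1) h4 ((h.fpos_iff (h.D_U (h.neg_D h1))).1 h3)
  · rintro ⟨h1, h2⟩
    refine ⟨⟨h1, fun h3 => h2 ⟨h1, Or.inl h3⟩⟩, ?_⟩
    rcases h.pos_or (D_univ h1) with h4 | h4
    · exact absurd ⟨h1, Or.inr h4⟩ h2
    · exact (h.fpos_iff (h.D_U (h.neg_D h1))).2 h4

theorem mem_compl {J K : Set ι} {u : V ≃ₗ[ℝ] V} (hu : u ∈ WoJ r J) {P : Set V}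
    (hP : P = u '' DeloKJneg α r J K) (x : V) :
    u x ∈ DeloJ α r J \ P ↔ x ∈ h.Qs J K := by
  rw [hP, Set.mem_sdiff, u.injective.mem_set_image, h.mem_N, W_D_iff hu]
  constructor
  · rintro ⟨h1, h2⟩
    by_contra hc
    exact h2 ⟨h1, hc⟩
  · intro h1
    exact ⟨h1.1, fun h2 => h2.2 h1⟩

theorem eq_image {J K : Set ι} {u : V ≃ₗ[ℝ] V} (hu : u ∈ WoJ r J) {P : Set V}
    (hPJ : P ⊆ DeloJ α r J)
    (hP : ∀ x, u x ∈ DeloJ α r J \ P ↔ x ∈ h.Qs J K) : P = u '' DeloKJneg α r J K := by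
  ext y
  obtain ⟨x, rfl⟩ := u.surjective y
  rw [u.injective.mem_set_image, h.mem_N, ← hP, Set.mem_sdiff, W_D_iff hu]
  constructor
  · intro hx
    exact ⟨(W_D_iff hu).1 (hPJ hx), fun h1 => h1.2 hx⟩
  · rintro ⟨h1, h2⟩
    by_contra hc
    exact h2 ⟨h1, hc⟩

theorem Qs_closed {J K : Set ι} {x y : V} (hx : x ∈ h.Qs J K) (hy : y ∈ h.Qs J K)
    (hxy : x + y ∈ DeloJ α r Set.univ) : x + y ∈ h.Qs J K := by
  have key : ∀ z ∈ h.Qs J K, ∀ i ∉ K, 0 ≤ h.C z i := by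
    rintro z ⟨-, hz | hz⟩ i hi
    · rw [(h.mem_DJ.1 hz).2 i hi]
    · exact hz i
  refine ⟨h.mem_DJ.2 ⟨hxy, fun i hi => ?_⟩, ?_⟩
  · rw [map_add, Pi.add_apply, (h.mem_DJ.1 hx.1).2 i hi, (h.mem_DJ.1 hy.1).2 i hi, add_zero]
  · by_cases hz : ∀ i ∉ K, h.C (x + y) i = 0
    · exact Or.inl (h.mem_DJ.2 ⟨hxy, hz⟩)
    · push Not at hz
      obtain ⟨i, hi, hc⟩ := hz
      refine Or.inr (h.pos_of_coord hxy (i := i) (lt_of_le_of_ne ?_ (Ne.symm hc)))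
      rw [map_add, Pi.add_apply]
      exact add_nonneg (key x hx i hi) (key y hy i hi)

theorem Qs_W {J K : Set ι} (hKJ : K ⊆ J) {g : V ≃ₗ[ℝ] V} (hg : g ∈ WoJ r K) {x : V}
    (hx : x ∈ h.Qs J K) : g x ∈ h.Qs J K := by
  refine ⟨W_D (W_mono hKJ hg) hx.1, ?_⟩
  by_cases hK : x ∈ DeloJ α r K
  · exact Or.inl (W_D hg hK)
  have hp := hx.2.resolve_left hK
  have : ∃ i, i ∉ K ∧ h.C x i ≠ 0 := by
    by_contra! hc
    exact hK (h.mem_DJ.2 ⟨D_univ hx.1, hc⟩)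
  obtain ⟨i, hi, hc⟩ := this
  refine Or.inr (h.pos_of_coord (D_univ (W_D (W_mono hKJ hg) hx.1)) (i := i) ?_)
  rw [h.C_W_ne hg _ hi]
  exact lt_of_le_of_ne (hp i) (Ne.symm hc)

theorem Qs_W_iff {J K : Set ι} (hKJ : K ⊆ J) {g : V ≃ₗ[ℝ] V} (hg : g ∈ WoJ r K) {x : V} :
    g x ∈ h.Qs J K ↔ x ∈ h.Qs J K := by
  refine ⟨fun hx => ?_, h.Qs_W hKJ hg⟩
  have := h.Qs_W hKJ (inv_mem hg) hx
  rw [← LinearEquiv.mul_apply] at this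
  simpa using this

theorem neg_α_mem_Qs {J K : Set ι} {j : ι} (hj : j ∈ J) : -α j ∈ h.Qs J K ↔ j ∈ K := by
  constructor
  · rintro ⟨-, h1 | h1⟩
    · by_contra hc
      have := (h.mem_DJ.1 h1).2 j hc
      simp [h.C_self] at this
    · exact absurd h1 (h.not_pos_neg (α_mem (Set.mem_univ j)) (h.pos_α j))
  · intro hK
    exact ⟨h.neg_D (α_mem hj), Or.inl (h.neg_D (α_mem hK))⟩

/-- A parabolic set contains a positive system. -/
theorem exists_posSystem {J : Set ι} {Q : Set V}
    (hc : ClosedIn (DeloJ α r Set.univ) Q) (hpar : ∀ v ∈ DeloJ α r J, v ∈ Q ∨ -v ∈ Q) (n : ℕ) :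
    ∀ u ∈ WoJ r J, {v | v ∈ DeloJ α r J ∧ h.Pos v ∧ u v ∉ Q}.ncard ≤ n →
      ∃ u ∈ WoJ r J, ∀ v ∈ DeloJ α r J, h.Pos v → u v ∈ Q := by
  have hfin : ∀ u : V ≃ₗ[ℝ] V, {v | v ∈ DeloJ α r J ∧ h.Pos v ∧ u v ∉ Q}.Finite := fun u =>
    h.finite.subset fun v hv => D_univ hv.1
  induction n with
  | zero =>
    intro u hu hn
    refine ⟨u, hu, fun v hv hp => ?_⟩
    by_contra hc
    have := (Set.ncard_eq_zero (hfin u)).1 (by omega)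
    exact (Set.eq_empty_iff_forall_notMem.1 this v) ⟨hv, hp, hc⟩
  | succ n ih =>
    intro u hu hn
    by_cases hs : ∀ j ∈ J, u (α j) ∈ Q
    · refine ⟨u, hu, fun v hv hp => ?_⟩
      refine h.pos_induction (fun v => u v ∈ Q) hs ?_ hv hp
      intro β j hj hβ _ hβj hβQ
      have := hc _ hβQ _ (hs j hj) (by rw [← map_add]; exact D_univ (W_D hu hβj))
      rwa [← map_add] at this
    · push Not at hs
      obtain ⟨j, hj, hjQ⟩ := hs
      refine ih (u * r j) (mul_mem hu (r_mem hj)) ?_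
      have hlt : {v | v ∈ DeloJ α r J ∧ h.Pos v ∧ (u * r j) v ∉ Q}.ncard <
          {v | v ∈ DeloJ α r J ∧ h.Pos v ∧ u v ∉ Q}.ncard := by
        rw [← Set.ncard_image_of_injective _ (r j).injective]
        apply Set.ncard_lt_ncard _ (hfin u)
        refine (Set.ssubset_iff_of_subset ?_).2 ⟨α j, ⟨α_mem hj, h.pos_α j, hjQ⟩, ?_⟩
        · rintro _ ⟨v, ⟨h1, h2, h3⟩, rfl⟩
          refine ⟨W_D (r_mem hj) h1, h.pos_r (D_univ h1) h2 ?_, h3⟩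
          rintro rfl
          rw [LinearEquiv.mul_apply, h.refl_self, map_neg] at h3
          rcases hpar _ (W_D hu (α_mem hj)) with h4 | h4
          · exact hjQ h4
          · exact h3 h4
        · rintro ⟨v, ⟨h1, h2, h3⟩, e⟩
          have : v = -α j := by
            rw [← h.r_r j v, e, h.refl_self]
          rw [this] at h2
          exact h.not_pos_neg (α_mem (Set.mem_univ j)) (h.pos_α j) h2
      omega

theorem exists_K {J : Set ι} {Q : Set V}
    (hc : ClosedIn (DeloJ α r Set.univ) Q) (hQJ : Q ⊆ DeloJ α r J)
    {u : V ≃ₗ[ℝ] V} (hu : u ∈ WoJ r J) (hpos : ∀ v ∈ DeloJ α r J, h.Pos v → u v ∈ Q) :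
    ∃ K ⊆ J, ∀ x, u x ∈ Q ↔ x ∈ h.Qs J K := by
  refine ⟨{j | j ∈ J ∧ u (-α j) ∈ Q}, fun j hj => hj.1, ?_⟩
  set K : Set ι := {j | j ∈ J ∧ u (-α j) ∈ Q} with hK
  have hKJ : K ⊆ J := fun j hj => hj.1
  have hc' : ∀ x y, u x ∈ Q → u y ∈ Q → x + y ∈ DeloJ α r J → u (x + y) ∈ Q := by
    intro x y hx hy hxy
    have := hc _ hx _ hy (by rw [← map_add]; exact D_univ (W_D hu hxy))
    rwa [← map_add] at this
  intro x
  constructor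
  · intro hx
    have hxJ := (W_D_iff hu).1 (hQJ hx)
    refine ⟨hxJ, ?_⟩
    rcases h.pos_or (D_univ hxJ) with hp | hp
    · exact Or.inr hp
    left
    rw [← h.neg_D_iff]
    refine h.pos_induction (J := J) (fun β => u (-β) ∈ Q → β ∈ DeloJ α r K) ?_ ?_
      (h.neg_D hxJ) hp (by simpa using hx)
    · intro j hj hjQ
      exact α_mem ⟨hj, hjQ⟩
    · intro β j hj hβ hβp hβj ih hQ
      have h1 : u (-β) ∈ Q := by
        have := hc' (-(β + α j)) (α j) hQ (hpos _ (α_mem hj) (h.pos_α j))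
        rw [show -(β + α j) + α j = -β by abel] at this
        exact this (h.neg_D hβ)
      have h2 : u (-α j) ∈ Q := by
        have := hc' (-(β + α j)) β hQ (hpos _ hβ hβp)
        rw [show -(β + α j) + β = -α j by abel] at this
        exact this (h.neg_D (α_mem hj))
      have hjK : j ∈ K := ⟨hj, h2⟩
      refine h.mem_DJ.2 ⟨D_univ hβj, fun i hi => ?_⟩
      rw [map_add, Pi.add_apply, (h.mem_DJ.1 (ih h1)).2 i hi,
        h.C_ne (by rintro rfl; exact hi hjK), add_zero]
  · rintro ⟨hxJ, hx⟩
    rcases h.pos_or (D_univ hxJ) with hp | hp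
    · exact hpos x hxJ hp
    have hxK : x ∈ DeloJ α r K := by
      rcases hx with hx | hx
      · exact hx
      · exact absurd hp (h.not_pos_neg (D_univ hxJ) hx)
    have := h.pos_induction (J := K) (fun β => u (-β) ∈ Q) (fun j hj => hj.2) ?_
      (h.neg_D hxK) hp
    · simpa using this
    · intro β j hj _ _ hβj hβ
      have := hc' (-β) (-α j) hβ hj.2
      rw [show -β + -α j = -(β + α j) by abel] at this
      exact this (h.neg_D (D_mono hKJ hβj))

theorem exists_min {J K : Set ι} (hKJ : K ⊆ J) {u : V ≃ₗ[ℝ] V} (hu : u ∈ WoJ r J) :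
    ∃ v ∈ WoJ r K, u * v ∈ MinReps r J K := by
  let S : Set ℕ := (fun v => lenG (Set.range r) (u * v)) '' (WoJ r K : Set (V ≃ₗ[ℝ] V))
  have hS : S.Nonempty := ⟨_, 1, one_mem _, rfl⟩
  obtain ⟨v, hv, e⟩ := Nat.sInf_mem hS
  refine ⟨v, hv, mul_mem hu (W_mono hKJ hv), fun w hw => ?_⟩
  simp only at e
  rw [e, mul_assoc]
  exact Nat.sInf_le ⟨v * w, mul_mem hv hw, rfl⟩

theorem unique_aux {J K K' : Set ι} {Q : Set V} {u u' : V ≃ₗ[ℝ] V}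
    (hu : u ∈ MinReps r J K) (hu' : u' ∈ MinReps r J K')
    (hQ : ∀ x, u x ∈ Q ↔ x ∈ h.Qs J K) (hQ' : ∀ x, u' x ∈ Q ↔ x ∈ h.Qs J K') :
    u = u' := by
  have key : u⁻¹ * u' = 1 := by
    have hw : u⁻¹ * u' ∈ WoJ r J := mul_mem (inv_mem hu.1) hu'.1
    refine h.eq_one_of_pos hw ?_
    intro j hj
    have hα : α j ∈ DeloJ α r J := α_mem hj
    set a := (u⁻¹ * u') (α j) with ha
    have hua : u a = u' (α j) := by
      rw [ha, ← LinearEquiv.mul_apply, mul_inv_cancel_left]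
    have haJ : a ∈ DeloJ α r J := W_D hw hα
    have h1 : a ∈ h.Qs J K := by
      rw [← hQ, hua, hQ']
      exact ⟨hα, Or.inr (h.pos_α j)⟩
    rcases h1.2 with h2 | h2
    swap
    · exact h2
    by_contra hna
    have hpa : h.Pos (-a) := (h.pos_or (D_univ haJ)).resolve_left hna
    have h3 : -α j ∈ h.Qs J K' := by
      rw [← hQ', map_neg, ← hua, ← map_neg, hQ]
      exact ⟨h.neg_D haJ, Or.inl (h.neg_D h2)⟩
    have h4 : j ∈ K' := (h.neg_α_mem_Qs hj).1 h3
    have h5 := h.minRep_pos hu' h4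
    have h6 := h.minRep_pos' hu (h.neg_D h2) hpa
    rw [map_neg, hua] at h6
    exact h.not_pos_neg (D_univ (W_D hu'.1 hα)) h5 h6
  exact (inv_mul_eq_one.1 key)

end SimpleRootSystem

/-- Proposition 4.6: for nonempty `J ⊆ ∘I` and `P ⊆ ∘Δ_J`, the following are equivalent:
(i) `P` is a pointed biclosed set in `∘Δ_J`; (ii) `P` is a pointed coclosed set in `∘Δ_J`;
(iii) `∘Δ_J ∖ P` is a parabolic set in `∘Δ_J`; (iv) `P = u∘Δ^K_{J−}` for a unique `K ⊆ J`
and a unique `u ∈ ∘W^K_J`. -/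
theorem statement9 (α : ι → V) (r : ι → V ≃ₗ[ℝ] V) (h : SimpleRootSystem α r)
    (J : Set ι) (hJ : J.Nonempty) (P : Set V) (hP : P ⊆ DeloJ α r J) :
    ((P ∩ (-P) = ∅ ∧ ClosedIn (DeloJ α r Set.univ) P ∧
        ClosedIn (DeloJ α r Set.univ) (DeloJ α r J \ P)) ↔
      (P ∩ (-P) = ∅ ∧ ClosedIn (DeloJ α r Set.univ) (DeloJ α r J \ P))) ∧
    ((P ∩ (-P) = ∅ ∧ ClosedIn (DeloJ α r Set.univ) (DeloJ α r J \ P)) ↔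
      (ClosedIn (DeloJ α r Set.univ) (DeloJ α r J \ P) ∧
        (DeloJ α r J \ P) ∪ (-(DeloJ α r J \ P)) = DeloJ α r J)) ∧
    ((ClosedIn (DeloJ α r Set.univ) (DeloJ α r J \ P) ∧
        (DeloJ α r J \ P) ∪ (-(DeloJ α r J \ P)) = DeloJ α r J) ↔
      (∃! ku : Set ι × (V ≃ₗ[ℝ] V),
        ku.1 ⊆ J ∧ ku.2 ∈ MinReps r J ku.1 ∧ P = ⇑ku.2 '' DeloKJneg α r J ku.1)) := by
  have hneg : ∀ {v : V}, v ∈ DeloJ α r J → -v ∈ DeloJ α r J := fun hv => h.neg_D hv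
  refine ⟨?_, ?_, ?_⟩
  · constructor
    · rintro ⟨h1, -, h2⟩
      exact ⟨h1, h2⟩
    · rintro ⟨h1, h2⟩
      refine ⟨h1, ?_, h2⟩
      have hpt : ∀ v ∈ P, -v ∈ DeloJ α r J \ P := by
        intro v hv
        refine ⟨hneg (hP hv), fun hc => ?_⟩
        have : v ∈ P ∩ (-P) := ⟨hv, by simpa using hc⟩
        rw [h1] at this
        exact this
      intro ε hε η hη hs
      by_contra hc
      have h3 := h2 _ (hpt ε hε) _ (hpt η hη) (by
        rw [← neg_add]; exact h.neg_D hs)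
      have h4 : ε + η ∈ DeloJ α r J \ P := by
        refine ⟨?_, hc⟩
        have := hneg h3.1
        rwa [← neg_add, neg_neg] at this
      have h5 := h2 _ h4 _ (hpt η hη)
      rw [add_neg_cancel_right] at h5
      exact (h5 (SimpleRootSystem.D_univ (hP hε))).2 hε
  · constructor
    · rintro ⟨h1, h2⟩
      refine ⟨h2, ?_⟩
      ext v
      constructor
      · rintro (hv | hv)
        · exact hv.1
        · exact h.neg_D_iff.1 hv.1
      · intro hv
        by_cases hvP : v ∈ P
        · refine Or.inr ⟨hneg hv, fun hc => ?_⟩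
          have : v ∈ P ∩ (-P) := ⟨hvP, hc⟩
          rw [h1] at this
          exact this
        · exact Or.inl ⟨hv, hvP⟩
    · rintro ⟨h1, h2⟩
      refine ⟨?_, h1⟩
      rw [Set.eq_empty_iff_forall_notMem]
      rintro v ⟨hv, hv'⟩
      have : v ∈ DeloJ α r J := hP hv
      rw [← h2] at this
      rcases this with h3 | h3
      · exact h3.2 hv
      · exact h3.2 hv'
  · constructor
    · rintro ⟨h1, h2⟩
      have hpar : ∀ v ∈ DeloJ α r J, v ∈ DeloJ α r J \ P ∨ -v ∈ DeloJ α r J \ P := by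
        intro v hv
        rw [← h2] at hv
        exact hv
      obtain ⟨u, hu, hpos⟩ := h.exists_posSystem h1 hpar _ 1 (one_mem _) le_rfl
      obtain ⟨K, hKJ, hK⟩ := h.exists_K h1 Set.sdiff_subset hu hpos
      obtain ⟨v, hv, hmin⟩ := SimpleRootSystem.exists_min hKJ hu
      refine ⟨(K, u * v), ⟨hKJ, hmin, ?_⟩, ?_⟩
      · refine h.eq_image hmin.1 hP fun x => ?_
        rw [LinearEquiv.mul_apply, hK, h.Qs_W_iff hKJ hv]
      · rintro ⟨K', u'⟩ ⟨hKJ', hmin', hP'⟩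
        simp only at hKJ' hmin' hP'
        have hQ' := h.mem_compl hmin'.1 hP'
        have hQ : ∀ x, (u * v) x ∈ DeloJ α r J \ P ↔ x ∈ h.Qs J K := by
          intro x
          rw [LinearEquiv.mul_apply, hK, h.Qs_W_iff hKJ hv]
        have e : u' = u * v := h.unique_aux hmin' hmin hQ' hQ
        have eK : K' = K := by
          ext j
          constructor
          · intro hj
            rw [← h.neg_α_mem_Qs (hKJ' hj), ← hQ, ← e, hQ', h.neg_α_mem_Qs (hKJ' hj)]
            exact hj
          · intro hj
            rw [← h.neg_α_mem_Qs (hKJ hj), ← hQ', e, hQ, h.neg_α_mem_Qs (hKJ hj)]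
            exact hj
        rw [e, eK]
    · rintro ⟨⟨K, u⟩, ⟨hKJ, hmin, hP'⟩, -⟩
      simp only at hKJ hmin hP'
      have hQ := h.mem_compl hmin.1 hP'
      constructor
      · intro ε hε η hη hs
        obtain ⟨x, rfl⟩ := u.surjective ε
        obtain ⟨y, rfl⟩ := u.surjective η
        rw [← map_add] at hs ⊢
        rw [hQ] at hε hη ⊢
        exact h.Qs_closed hε hη ((SimpleRootSystem.W_D_iff
          (SimpleRootSystem.W_mono (Set.subset_univ J) hmin.1)).1 hs)
      · ext y
        constructor
        · rintro (hv | hv)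
          · exact hv.1
          · exact h.neg_D_iff.1 hv.1
        · intro hy
          obtain ⟨x, rfl⟩ := u.surjective y
          have hx := (SimpleRootSystem.W_D_iff hmin.1).1 hy
          rcases h.pos_or (SimpleRootSystem.D_univ hx) with hp | hp
          · exact Or.inl ((hQ x).2 ⟨hx, Or.inr hp⟩)
          · refine Or.inr ?_
            rw [Set.mem_neg, ← map_neg]
            exact (hQ (-x)).2 ⟨hneg hx, Or.inr hp⟩

end
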